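/- Let m, n ∈ ℕ_0, Z ∈ {X, Y, XY, WI}, and let γ be a π-term over a finite alphabet Σ. Then [γ]_k ≡_{m,n}^Z [γ]_{ω+ω*} for all k ∈ ℕ_0 with k > n. -/

import Mathlib

open scoped Classical

/-! ## Generalized words -/

structure GWord (A : Type) : Type 1 where
  P : Type
  ord : LinearOrder P
  w : P → A

namespace GWord

variable {A : Type}

instance (u : GWord A) : LinearOrder u.P := u.ord

/-- The set of letters occurring in a generalized word. -/
def alph (u : GWord A) : Set A := Set.range u.w

/-- Restriction of a generalized word to a set of positions. -/
def restrict (u : GWord A) (s : Set u.P) : GWord A :=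
  ⟨{ p // p ∈ s }, inferInstance, fun p => u.w p.1⟩

/-- `p` is the first `a`-labelled position of `u`. -/
def IsFirst (u : GWord A) (a : A) (p : u.P) : Prop :=
  u.w p = a ∧ ∀ q : u.P, u.w q = a → p ≤ q

/-- `p` is the last `a`-labelled position of `u`. -/
def IsLast (u : GWord A) (a : A) (p : u.P) : Prop :=
  u.w p = a ∧ ∀ q : u.P, u.w q = a → q ≤ p

/-- The factor strictly before the first occurrence of `a`. -/
noncomputable def XL (u : GWord A) (a : A) : GWord A :=
  if h : ∃ p, u.IsFirst a p then u.restrict {q | q < h.choose} else u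

/-- The factor strictly after the first occurrence of `a`. -/
noncomputable def XR (u : GWord A) (a : A) : GWord A :=
  if h : ∃ p, u.IsFirst a p then u.restrict {q | h.choose < q} else u

/-- The factor strictly before the last occurrence of `a`. -/
noncomputable def YL (u : GWord A) (a : A) : GWord A :=
  if h : ∃ p, u.IsLast a p then u.restrict {q | q < h.choose} else u

/-- The factor strictly after the last occurrence of `a`. -/
noncomputable def YR (u : GWord A) (a : A) : GWord A :=
  if h : ∃ p, u.IsLast a p then u.restrict {q | h.choose < q} else u

/-- `C_{a,b}` is defined iff the first `a` is strictly to the right of the last `b`. -/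
def CDefined (u : GWord A) (a b : A) : Prop :=
  ∃ p q, u.IsFirst a p ∧ u.IsLast b q ∧ q < p

/-- The factor strictly between the last `b` and the first `a` (junk value if undefined). -/
noncomputable def Cab (u : GWord A) (a b : A) : GWord A :=
  if h : u.CDefined a b then
    u.restrict {r | h.choose_spec.choose < r ∧ r < h.choose}
  else u

/-- Accessibility: first/last occurrences of letters after/before every position exist. -/
def Accessible (u : GWord A) : Prop :=
  (∀ a : A, (∃ p, u.w p = a) → ∃ p, u.IsFirst a p) ∧
  (∀ a : A, (∃ p, u.w p = a) → ∃ p, u.IsLast a p) ∧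
  (∀ (p : u.P) (a : A), (∃ q, p < q ∧ u.w q = a) →
    ∃ q, p < q ∧ u.w q = a ∧ ∀ r, p < r → u.w r = a → q ≤ r) ∧
  (∀ (p : u.P) (a : A), (∃ q, q < p ∧ u.w q = a) →
    ∃ q, q < p ∧ u.w q = a ∧ ∀ r, r < p → u.w r = a → r ≤ q)

/-- Concatenation of generalized words. -/
def append (u v : GWord A) : GWord A :=
  ⟨u.P ⊕ₗ v.P, inferInstance, fun x => Sum.elim u.w v.w (ofLex x)⟩

/-- The power of a generalized word by an arbitrary linear order type `ν`
(positions ordered with the exponent component dominant). -/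
def gpow (u : GWord A) (ν : Type) [LinearOrder ν] : GWord A :=
  ⟨ν ×ₗ u.P, inferInstance, fun x => u.w (ofLex x).2⟩

/-- A finite word as a generalized word. -/
def ofList (l : List A) : GWord A :=
  ⟨Fin l.length, inferInstance, fun i => l.get i⟩

end GWord

/-- The order type `ω + ω*`: a copy of `ℕ` followed by a reversed copy of `ℕ`. -/
abbrev OO : Type := ℕ ⊕ₗ ℕᵒᵈ

/-! ## The relations `≡_{m,n}^Z` -/

inductive ZK : Type
  | X | Y | WI

inductive ZKind : Type
  | X | Y | XY | WI

/-- The relations `≡_{m,n}^X`, `≡_{m,n}^Y`, `≡_{m,n}^{WI}` (first argument is `n`). -/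
def eqvAux {A : Type} : ℕ → ZK → ℕ → GWord A → GWord A → Prop
  | 0, _, _, _, _ => True
  | _ + 1, _, 0, _, _ => True
  | n + 1, ZK.X, m + 1, u, v =>
      u.alph = v.alph ∧ eqvAux n ZK.Y m u v ∧
      ∀ a ∈ u.alph, eqvAux n ZK.Y m (u.XL a) (v.XL a) ∧
        eqvAux n ZK.X (m + 1) (u.XR a) (v.XR a)
  | n + 1, ZK.Y, m + 1, u, v =>
      u.alph = v.alph ∧ eqvAux n ZK.X m u v ∧
      ∀ a ∈ u.alph, eqvAux n ZK.Y (m + 1) (u.YL a) (v.YL a) ∧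
        eqvAux n ZK.X m (u.YR a) (v.YR a)
  | n + 1, ZK.WI, m + 1, u, v =>
      u.alph = v.alph ∧
      (∀ a ∈ u.alph,
        eqvAux n ZK.WI m (u.XL a) (v.XL a) ∧ eqvAux n ZK.WI (m + 1) (u.XR a) (v.XR a) ∧
        eqvAux n ZK.WI (m + 1) (u.YL a) (v.YL a) ∧ eqvAux n ZK.WI m (u.YR a) (v.YR a)) ∧
      ∀ a ∈ u.alph, ∀ b ∈ u.alph,
        (u.CDefined a b ↔ v.CDefined a b) ∧
        (u.CDefined a b → v.CDefined a b → eqvAux n ZK.WI m (u.Cab a b) (v.Cab a b))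

/-- `wEquiv Z m n u v` is `u ≡_{m,n}^Z v`. -/
def wEquiv {A : Type} (Z : ZKind) (m n : ℕ) (u v : GWord A) : Prop :=
  match Z with
  | ZKind.X => eqvAux n ZK.X m u v
  | ZKind.Y => eqvAux n ZK.Y m u v
  | ZKind.XY => eqvAux n ZK.X m u v ∧ eqvAux n ZK.Y m u v
  | ZKind.WI => eqvAux n ZK.WI m u v

/-! ## π-terms -/

inductive PiTerm (A : Type) : Type
  | eps : PiTerm A
  | letter : A → PiTerm A
  | mul : PiTerm A → PiTerm A → PiTerm A
  | pi : PiTerm A → PiTerm A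

def listNPow {A : Type} (l : List A) : ℕ → List A
  | 0 => []
  | k + 1 => l ++ listNPow l k

/-- `[γ]_k`: substitute the natural number `k` for the formal power `π`. -/
def PiTerm.substNat {A : Type} : PiTerm A → ℕ → List A
  | .eps, _ => []
  | .letter a, _ => [a]
  | .mul α β, k => α.substNat k ++ β.substNat k
  | .pi γ, k => listNPow (γ.substNat k) k

/-- `[γ]_{ω+ω*}`: substitute the order type `ω + ω*` for the formal power `π`. -/
def PiTerm.substOO {A : Type} : PiTerm A → GWord A
  | .eps => GWord.ofList []
  | .letter a => GWord.ofList [a]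
  | .mul α β => α.substOO.append β.substOO
  | .pi γ => γ.substOO.gpow OO

/-! ## Finite monoids, equations, the Trotter–Weil hierarchy -/

/-- `M!`: the exponent of a finite monoid, the least `n ≥ 1` such that all `x^n` are
idempotent. -/
noncomputable def monoidExp (M : Type) [Monoid M] : ℕ :=
  sInf {n : ℕ | 1 ≤ n ∧ ∀ x : M, IsIdempotentElem (x ^ n)}

/-- The equation `α = β` of π-terms holds in the finite monoid `M`. -/
def EqHoldsIn {A : Type} (α β : PiTerm A) (M : Type) [Monoid M] : Prop :=
  ∀ σ : FreeMonoid A →* M,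
    σ (FreeMonoid.ofList (α.substNat (monoidExp M))) =
      σ (FreeMonoid.ofList (β.substNat (monoidExp M)))

/-- Green's relation `R`: `x R y` iff `xM = yM`. -/
def rGreen {M : Type} [Monoid M] (x y : M) : Prop :=
  Set.range (fun z => x * z) = Set.range (fun z => y * z)

/-- Green's relation `L`: `x L y` iff `Mx = My`. -/
def lGreen {M : Type} [Monoid M] (x y : M) : Prop :=
  Set.range (fun z => z * x) = Set.range (fun z => z * y)

/-- `J`-triviality: `MxM = MyM` implies `x = y`. -/
def IsJTrivial (M : Type) [Monoid M] : Prop :=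
  ∀ x y : M, {z | ∃ a b, z = a * x * b} = {z | ∃ a b, z = a * y * b} → x = y

/-- The relation `∼_K`. -/
def simK {M : Type} [Monoid M] (x y : M) : Prop :=
  ∀ e : M, IsIdempotentElem e → (rGreen (e * x) e ∨ rGreen (e * y) e) → e * x = e * y

/-- The relation `∼_D`. -/
def simD {M : Type} [Monoid M] (x y : M) : Prop :=
  ∀ e : M, IsIdempotentElem e → (lGreen (x * e) e ∨ lGreen (y * e) e) → x * e = y * e

/-- `∼_K` as a congruence (it is a congruence, so `conGen` does not change it). -/
def KCon (M : Type) [Monoid M] : Con M := conGen simK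

/-- `∼_D` as a congruence. -/
def DCon (M : Type) [Monoid M] : Con M := conGen simD

/-- `InRLAux k true M _ = (M ∈ R_{k+1})` and `InRLAux k false M _ = (M ∈ L_{k+1})`. -/
def InRLAux : ℕ → Bool → (M : Type) → Monoid M → Prop
  | 0, _, M, i => letI := i; IsJTrivial M
  | k + 1, true, M, i => letI := i; InRLAux k false (KCon M).Quotient inferInstance
  | k + 1, false, M, i => letI := i; InRLAux k true (DCon M).Quotient inferInstance

/-- `M ∈ R_m` (for `m ≥ 1`). -/
def InRm (m : ℕ) (M : Type) [i : Monoid M] : Prop := InRLAux (m - 1) true M i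

/-- `M ∈ L_m` (for `m ≥ 1`). -/
def InLm (m : ℕ) (M : Type) [i : Monoid M] : Prop := InRLAux (m - 1) false M i

/-- `N` divides `M`: `N` is a homomorphic image of a submonoid of `M`. -/
def MDivides (N M : Type) [Monoid N] [Monoid M] : Prop :=
  ∃ (S : Submonoid M) (f : S →* N), Function.Surjective f

/-- `N ∈ R_m ∨ L_m`: `N` divides a direct product `M₁ × M₂` with `M₁ ∈ R_m`, `M₂ ∈ L_m`. -/
def InJoin (m : ℕ) (N : Type) [Monoid N] : Prop :=
  ∃ (M₁ M₂ : Type) (i₁ : Monoid M₁) (i₂ : Monoid M₂),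
    letI := i₁; letI := i₂;
    Finite M₁ ∧ Finite M₂ ∧ InRm m M₁ ∧ InLm m M₂ ∧ MDivides N (M₁ × M₂)

/-- `M ∈ DA`, via the equation `(xyz)^{M!} y (xyz)^{M!} = (xyz)^{M!}`. -/
def InDA (M : Type) [Monoid M] : Prop :=
  ∀ x y z : M,
    (x * y * z) ^ monoidExp M * y * (x * y * z) ^ monoidExp M = (x * y * z) ^ monoidExp M

/-! ## The π-terms `U_m`, `V_m` -/

inductive UVLetter : Type
  | s | t | x (i : ℕ) | y (i : ℕ)

/-- `U_m` (indexed from 1; `Uterm 0` is a junk value). -/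
def Uterm : ℕ → PiTerm UVLetter
  | 0 => PiTerm.eps
  | 1 =>
      PiTerm.mul
        (PiTerm.pi (PiTerm.mul (PiTerm.letter UVLetter.s) (PiTerm.letter (UVLetter.x 1))))
        (PiTerm.mul (PiTerm.letter UVLetter.s)
          (PiTerm.pi (PiTerm.mul (PiTerm.letter (UVLetter.y 1)) (PiTerm.letter UVLetter.t))))
  | m + 2 =>
      PiTerm.mul
        (PiTerm.pi (PiTerm.mul (Uterm (m + 1)) (PiTerm.letter (UVLetter.x (m + 2)))))
        (PiTerm.mul (Uterm (m + 1))
          (PiTerm.pi (PiTerm.mul (PiTerm.letter (UVLetter.y (m + 2))) (Uterm (m + 1)))))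

/-- `V_m` (indexed from 1; `Vterm 0` is a junk value). -/
def Vterm : ℕ → PiTerm UVLetter
  | 0 => PiTerm.eps
  | 1 =>
      PiTerm.mul
        (PiTerm.pi (PiTerm.mul (PiTerm.letter UVLetter.s) (PiTerm.letter (UVLetter.x 1))))
        (PiTerm.mul (PiTerm.letter UVLetter.t)
          (PiTerm.pi (PiTerm.mul (PiTerm.letter (UVLetter.y 1)) (PiTerm.letter UVLetter.t))))
  | m + 2 =>
      PiTerm.mul
        (PiTerm.pi (PiTerm.mul (Uterm (m + 1)) (PiTerm.letter (UVLetter.x (m + 2)))))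
        (PiTerm.mul (Vterm (m + 1))
          (PiTerm.pi (PiTerm.mul (PiTerm.letter (UVLetter.y (m + 2))) (Uterm (m + 1)))))

/-- The relation `≡_{m,n}^Z` on the free monoid `Σ*`, as a congruence
(it is a congruence, so `conGen` does not change it). -/
def eqvCon (A : Type) (Z : ZKind) (m n : ℕ) : Con (FreeMonoid A) :=
  conGen (fun u v => wEquiv Z m n (GWord.ofList u.toList) (GWord.ofList v.toList))

namespace GWord

variable {A : Type}

/-! ## Isomorphism of generalized words -/

/-- Two generalized words are isomorphic if there is a label-preserving order isomorphism
between their sets of positions. -/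
def Iso (u v : GWord A) : Prop :=
  ∃ f : u.P → v.P, StrictMono f ∧ Function.Surjective f ∧ ∀ p, v.w (f p) = u.w p

theorem Iso.refl (u : GWord A) : u.Iso u :=
  ⟨id, strictMono_id, Function.surjective_id, fun _ => rfl⟩

theorem Iso.symm {u v : GWord A} (h : u.Iso v) : v.Iso u := by
  obtain ⟨f, hf, hs, hw⟩ := h
  obtain ⟨g, hg⟩ := hs.hasRightInverse
  refine ⟨g, fun x y hxy => ?_, fun p => ⟨f p, hf.injective (hg _)⟩, fun p => ?_⟩
  · rw [← hf.lt_iff_lt, hg, hg]; exact hxy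
  · rw [← hw, hg]

theorem Iso.trans {u v w : GWord A} (h : u.Iso v) (h' : v.Iso w) : u.Iso w := by
  obtain ⟨f, hf, hs, hw⟩ := h
  obtain ⟨g, hg, hs', hw'⟩ := h'
  exact ⟨g ∘ f, hg.comp hf, hs'.comp hs, fun p => (hw' _).trans (hw p)⟩

theorem iso_restrict {u v : GWord A} {f : u.P → v.P} (hf : StrictMono f)
    (hs : Function.Surjective f) (hw : ∀ p, v.w (f p) = u.w p) {s : Set u.P} {t : Set v.P}
    (hst : ∀ p, p ∈ s ↔ f p ∈ t) : (u.restrict s).Iso (v.restrict t) := by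
  refine ⟨fun p => ⟨f p.1, (hst _).1 p.2⟩, fun p q h => hf h, fun q => ?_, fun p => hw p.1⟩
  obtain ⟨p, hp⟩ := hs q.1
  exact ⟨⟨p, (hst p).2 (hp ▸ q.2)⟩, Subtype.ext hp⟩

theorem restrict_univ_iso (u : GWord A) : (u.restrict Set.univ).Iso u :=
  ⟨fun p => p.1, fun _ _ h => h, fun p => ⟨⟨p, trivial⟩, rfl⟩, fun _ => rfl⟩

theorem restrict_empty_iso (u v : GWord A) : (u.restrict ∅).Iso (v.restrict ∅) :=
  ⟨fun p => p.2.elim, fun p => p.2.elim, fun p => p.2.elim, fun p => p.2.elim⟩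

/-! ## Positions of a concatenation -/

/-- A position of the left factor as a position of the concatenation. -/
def appendL {u : GWord A} (v : GWord A) (p : u.P) : (u.append v).P := toLex (Sum.inl p)

/-- A position of the right factor as a position of the concatenation. -/
def appendR (u : GWord A) {v : GWord A} (p : v.P) : (u.append v).P := toLex (Sum.inr p)

theorem append_cases {u v : GWord A} (p : (u.append v).P) :
    (∃ q, p = appendL v q) ∨ ∃ q, p = appendR u q :=
  match p with
  | Sum.inlₗ q => Or.inl ⟨q, rfl⟩
  | Sum.inrₗ q => Or.inr ⟨q, rfl⟩

section

variable {u v : GWord A}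

@[simp] theorem w_appendL (p : u.P) : (u.append v).w (appendL v p) = u.w p := rfl

@[simp] theorem w_appendR (p : v.P) : (u.append v).w (appendR u p) = v.w p := rfl

@[simp] theorem appendL_lt_appendL {p q : u.P} : appendL v p < appendL v q ↔ p < q :=
  Sum.Lex.inl_lt_inl_iff

@[simp] theorem appendR_lt_appendR {p q : v.P} : appendR u p < appendR u q ↔ p < q :=
  Sum.Lex.inr_lt_inr_iff

@[simp] theorem appendL_lt_appendR (p : u.P) (q : v.P) : appendL v p < appendR u q :=
  Sum.Lex.inl_lt_inr p q

@[simp] theorem not_appendR_lt_appendL (p : u.P) (q : v.P) : ¬ appendR u q < appendL v p :=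
  Sum.Lex.not_inr_lt_inl

end

theorem alph_append (u v : GWord A) : (u.append v).alph = u.alph ∪ v.alph := by
  ext a
  constructor
  · rintro ⟨p, rfl⟩
    obtain ⟨q, rfl⟩ | ⟨q, rfl⟩ := append_cases p
    exacts [Or.inl ⟨q, rfl⟩, Or.inr ⟨q, rfl⟩]
  · rintro (⟨q, rfl⟩ | ⟨q, rfl⟩)
    exacts [⟨appendL v q, rfl⟩, ⟨appendR u q, rfl⟩]

theorem isFirst_appendL {u v : GWord A} {a : A} {p : u.P} :
    (u.append v).IsFirst a (appendL v p) ↔ u.IsFirst a p := by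
  refine and_congr Iff.rfl ⟨fun h q hq => ?_, fun h q hq => ?_⟩
  · simpa [← not_lt] using h (appendL v q) hq
  · obtain ⟨q, rfl⟩ | ⟨q, rfl⟩ := append_cases q
    · simpa [← not_lt] using h q hq
    · exact (appendL_lt_appendR _ _).le

theorem isFirst_appendR {u v : GWord A} {a : A} {p : v.P} :
    (u.append v).IsFirst a (appendR u p) ↔ a ∉ u.alph ∧ v.IsFirst a p := by
  refine ⟨fun h => ⟨?_, h.1, fun q hq => ?_⟩, fun h => ⟨h.2.1, fun q hq => ?_⟩⟩
  · rintro ⟨q, hq⟩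
    exact (h.2 (appendL v q) hq).not_gt (appendL_lt_appendR _ _)
  · simpa [← not_lt] using h.2 (appendR u q) hq
  · obtain ⟨q, rfl⟩ | ⟨q, rfl⟩ := append_cases q
    · exact (h.1 ⟨q, hq⟩).elim
    · simpa [← not_lt] using h.2.2 q hq

theorem isLast_appendR {u v : GWord A} {a : A} {p : v.P} :
    (u.append v).IsLast a (appendR u p) ↔ v.IsLast a p := by
  refine and_congr Iff.rfl ⟨fun h q hq => ?_, fun h q hq => ?_⟩
  · simpa [← not_lt] using h (appendR u q) hq
  · obtain ⟨q, rfl⟩ | ⟨q, rfl⟩ := append_cases q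
    · exact (appendL_lt_appendR _ _).le
    · simpa [← not_lt] using h q hq

theorem isLast_appendL {u v : GWord A} {a : A} {p : u.P} :
    (u.append v).IsLast a (appendL v p) ↔ a ∉ v.alph ∧ u.IsLast a p := by
  refine ⟨fun h => ⟨?_, h.1, fun q hq => ?_⟩, fun h => ⟨h.2.1, fun q hq => ?_⟩⟩
  · rintro ⟨q, hq⟩
    exact (h.2 (appendR u q) hq).not_gt (appendL_lt_appendR _ _)
  · simpa [← not_lt] using h.2 (appendL v q) hq
  · obtain ⟨q, rfl⟩ | ⟨q, rfl⟩ := append_cases q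
    · simpa [← not_lt] using h.2.2 q hq
    · exact (h.1 ⟨q, hq⟩).elim

theorem restrict_append_iso (u v : GWord A) (s : Set (u.append v).P) :
    ((u.append v).restrict s).Iso
      ((u.restrict (appendL v ⁻¹' s)).append (v.restrict (appendR u ⁻¹' s))) := by
  apply Iso.symm
  refine ⟨fun p => match p with
    | Sum.inlₗ q => ⟨appendL v q.1, q.2⟩
    | Sum.inrₗ q => ⟨appendR u q.1, q.2⟩, fun p q h => ?_, fun p => ?_, fun p => ?_⟩
  · obtain ⟨p, rfl⟩ | ⟨p, rfl⟩ := append_cases p <;> obtain ⟨q, rfl⟩ | ⟨q, rfl⟩ := append_cases q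
    · exact appendL_lt_appendL.2 (appendL_lt_appendL.1 h : p < q)
    · exact appendL_lt_appendR _ _
    · exact (not_appendR_lt_appendL _ _ h).elim
    · exact appendR_lt_appendR.2 (appendR_lt_appendR.1 h : p < q)
  · obtain ⟨p, hp⟩ := p
    obtain ⟨q, rfl⟩ | ⟨q, rfl⟩ := append_cases p
    · exact ⟨appendL _ ⟨q, hp⟩, rfl⟩
    · exact ⟨appendR _ ⟨q, hp⟩, rfl⟩
  · obtain ⟨q, rfl⟩ | ⟨q, rfl⟩ := append_cases p <;> rfl

/-! ## Finite words and powers -/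

theorem ofList_append_iso (l l' : List A) :
    (ofList (l ++ l')).Iso ((ofList l).append (ofList l')) := by
  apply Iso.symm
  have hl : (l ++ l').length = l.length + l'.length := List.length_append
  refine ⟨fun p => match p with
    | Sum.inlₗ (q : Fin l.length) => (⟨q.1, by omega⟩ : Fin (l ++ l').length)
    | Sum.inrₗ (q : Fin l'.length) => (⟨l.length + q.1, by omega⟩ : Fin (l ++ l').length),
    fun p q h => ?_, fun p => ?_, fun p => ?_⟩
  · obtain ⟨p, rfl⟩ | ⟨p, rfl⟩ := append_cases p <;> obtain ⟨q, rfl⟩ | ⟨q, rfl⟩ := append_cases q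
    · exact (appendL_lt_appendL.1 h : p < q)
    · exact Fin.lt_def.2 (lt_of_lt_of_le (Fin.is_lt (p : Fin l.length)) (Nat.le_add_right _ _))
    · exact (not_appendR_lt_appendL _ _ h).elim
    · exact Fin.lt_def.2 (Nat.add_lt_add_left (Fin.lt_def.1 (appendR_lt_appendR.1 h : p < q)) _)
  · obtain ⟨p, hp⟩ : Fin (l ++ l').length := p
    by_cases h : p < l.length
    · exact ⟨appendL _ (⟨p, h⟩ : Fin l.length), rfl⟩
    · exact ⟨appendR _ (⟨p - l.length, by omega⟩ : Fin l'.length),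
        Fin.ext (Nat.add_sub_cancel' (not_lt.1 h))⟩
  · obtain ⟨q, rfl⟩ | ⟨q, rfl⟩ := append_cases p
    · exact List.getElem_append_left (Fin.is_lt (q : Fin l.length))
    · change (l ++ l')[l.length + Fin.val q]'_ = l'[Fin.val q]'_
      simp

theorem alph_ofList (l : List A) : (ofList l).alph = {a | a ∈ l} := by
  ext a
  exact List.mem_iff_get.symm

theorem alph_gpow (u : GWord A) (ν : Type) [LinearOrder ν] [Nonempty ν] :
    (u.gpow ν).alph = u.alph := by
  ext a
  constructor
  · rintro ⟨p, rfl⟩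
    exact ⟨(ofLex p).2, rfl⟩
  · rintro ⟨p, rfl⟩
    exact ⟨toLex (Classical.arbitrary ν, p), rfl⟩

theorem gpow_iso_cons (u : GWord A) {ν : Type} [LinearOrder ν] {b : ν} {g : ν → ν}
    (hg : StrictMono g) (hb : ∀ i, b < g i) (hs : ∀ i, i = b ∨ ∃ j, g j = i) :
    (u.gpow ν).Iso (u.append (u.gpow ν)) := by
  apply Iso.symm
  refine ⟨fun p => match p with
    | Sum.inlₗ q => (toLex (b, q) : ν ×ₗ u.P)
    | Sum.inrₗ (q : ν ×ₗ u.P) => (toLex (g (ofLex q).1, (ofLex q).2) : ν ×ₗ u.P),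
    fun p q h => ?_, fun p => ?_, fun p => ?_⟩
  · obtain ⟨p, rfl⟩ | ⟨p, rfl⟩ := append_cases p <;> obtain ⟨q, rfl⟩ | ⟨q, rfl⟩ := append_cases q
    · exact Prod.Lex.toLex_lt_toLex.2 (Or.inr ⟨rfl, appendL_lt_appendL.1 h⟩)
    · exact Prod.Lex.toLex_lt_toLex.2 (Or.inl (hb _))
    · exact (not_appendR_lt_appendL _ _ h).elim
    · exact Prod.Lex.toLex_lt_toLex.2 ((Prod.Lex.lt_iff.1 (appendR_lt_appendR.1 h)).imp
        (fun h => hg h) (fun h => ⟨congrArg g h.1, h.2⟩))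
  · obtain ⟨i, p⟩ : ν ×ₗ u.P := p
    obtain rfl | ⟨j, rfl⟩ := hs i
    · exact ⟨appendL _ p, rfl⟩
    · exact ⟨appendR _ (toLex (j, p) : ν ×ₗ u.P), rfl⟩
  · obtain ⟨q, rfl⟩ | ⟨q, rfl⟩ := append_cases p <;> rfl

theorem gpow_iso_snoc (u : GWord A) {ν : Type} [LinearOrder ν] {b : ν} {g : ν → ν}
    (hg : StrictMono g) (hb : ∀ i, g i < b) (hs : ∀ i, i = b ∨ ∃ j, g j = i) :
    (u.gpow ν).Iso ((u.gpow ν).append u) := by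
  apply Iso.symm
  refine ⟨fun p => match p with
    | Sum.inlₗ (q : ν ×ₗ u.P) => (toLex (g (ofLex q).1, (ofLex q).2) : ν ×ₗ u.P)
    | Sum.inrₗ q => (toLex (b, q) : ν ×ₗ u.P),
    fun p q h => ?_, fun p => ?_, fun p => ?_⟩
  · obtain ⟨p, rfl⟩ | ⟨p, rfl⟩ := append_cases p <;> obtain ⟨q, rfl⟩ | ⟨q, rfl⟩ := append_cases q
    · exact Prod.Lex.toLex_lt_toLex.2 ((Prod.Lex.lt_iff.1 (appendL_lt_appendL.1 h)).imp
        (fun h => hg h) (fun h => ⟨congrArg g h.1, h.2⟩))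
    · exact Prod.Lex.toLex_lt_toLex.2 (Or.inl (hb _))
    · exact (not_appendR_lt_appendL _ _ h).elim
    · exact Prod.Lex.toLex_lt_toLex.2 (Or.inr ⟨rfl, appendR_lt_appendR.1 h⟩)
  · obtain ⟨i, p⟩ : ν ×ₗ u.P := p
    obtain rfl | ⟨j, rfl⟩ := hs i
    · exact ⟨appendR _ p, rfl⟩
    · exact ⟨appendL _ (toLex (j, p) : ν ×ₗ u.P), rfl⟩
  · obtain ⟨q, rfl⟩ | ⟨q, rfl⟩ := append_cases p <;> rfl

theorem gpow_OO_iso_cons (u : GWord A) : (u.gpow OO).Iso (u.append (u.gpow OO)) := by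
  refine u.gpow_iso_cons (b := Sum.inlₗ 0) (g := fun i => match i with
    | Sum.inlₗ j => Sum.inlₗ (j + 1)
    | Sum.inrₗ j => Sum.inrₗ j) ?_ ?_ ?_
  · rintro (i | i) (j | j) h
    · exact Sum.Lex.inl_lt_inl_iff.2 (Nat.succ_lt_succ (Sum.Lex.inl_lt_inl_iff.1 h))
    · exact Sum.Lex.inl_lt_inr _ _
    · exact (Sum.Lex.not_inr_lt_inl h).elim
    · exact h
  · rintro (i | i)
    · exact Sum.Lex.inl_lt_inl_iff.2 (Nat.succ_pos i)
    · exact Sum.Lex.inl_lt_inr _ _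
  · rintro ((_ | i) | i)
    exacts [Or.inl rfl, Or.inr ⟨Sum.inlₗ i, rfl⟩, Or.inr ⟨Sum.inrₗ i, rfl⟩]

theorem gpow_OO_iso_snoc (u : GWord A) : (u.gpow OO).Iso ((u.gpow OO).append u) := by
  refine u.gpow_iso_snoc (b := Sum.inrₗ (OrderDual.toDual 0)) (g := fun i => match i with
    | Sum.inlₗ j => Sum.inlₗ j
    | Sum.inrₗ j => Sum.inrₗ (OrderDual.toDual (OrderDual.ofDual j + 1))) ?_ ?_ ?_
  · rintro (i | i) (j | j) h
    · exact h
    · exact Sum.Lex.inl_lt_inr _ _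
    · exact (Sum.Lex.not_inr_lt_inl h).elim
    · have h' : i < j := Sum.Lex.inr_lt_inr_iff.1 h
      exact Sum.Lex.inr_lt_inr_iff.2
        (OrderDual.toDual_lt_toDual.2 (Nat.succ_lt_succ (OrderDual.ofDual_lt_ofDual.2 h')))
  · rintro (i | i)
    · exact Sum.Lex.inl_lt_inr _ _
    · exact Sum.Lex.inr_lt_inr_iff.2 (Nat.succ_pos (OrderDual.ofDual i))
  · rintro (i | (_ | i))
    exacts [Or.inr ⟨Sum.inlₗ i, rfl⟩, Or.inl rfl, Or.inr ⟨Sum.inrₗ (OrderDual.toDual i), rfl⟩]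

/-! ## Equivalence with respect to all factorizations -/

/-- Every factorization of `u` at a first occurrence is matched by one of `v`. -/
def FirstSim (R : GWord A → GWord A → Prop) (u v : GWord A) : Prop :=
  ∀ a p, u.IsFirst a p → ∃ q, v.IsFirst a q ∧
    R (u.restrict {r | r < p}) (v.restrict {r | r < q}) ∧
    R (u.restrict {r | p < r}) (v.restrict {r | q < r})

/-- Every factorization of `u` at a last occurrence is matched by one of `v`. -/
def LastSim (R : GWord A → GWord A → Prop) (u v : GWord A) : Prop :=
  ∀ a p, u.IsLast a p → ∃ q, v.IsLast a q ∧
    R (u.restrict {r | r < p}) (v.restrict {r | r < q}) ∧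
    R (u.restrict {r | p < r}) (v.restrict {r | q < r})

/-- Every factor of `u` between a last and a first occurrence is matched by one of `v`. -/
def BetweenSim (R : GWord A → GWord A → Prop) (u v : GWord A) : Prop :=
  ∀ a b p q, u.IsFirst a p → u.IsLast b q → q < p → ∃ p' q', v.IsFirst a p' ∧ v.IsLast b q' ∧
    q' < p' ∧ R (u.restrict {r | q < r ∧ r < p}) (v.restrict {r | q' < r ∧ r < p'})

/-- Every factorization of `u` is matched by one of `v` up to `R`. -/
structure Sim (R : GWord A → GWord A → Prop) (u v : GWord A) : Prop where
  alph : u.alph ⊆ v.alph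
  first : FirstSim R u v
  last : LastSim R u v
  between : BetweenSim R u v

/-- Equivalence of generalized words under `n` factorization steps of any kind. -/
def FgEquiv : ℕ → GWord A → GWord A → Prop
  | 0, _, _ => True
  | n + 1, u, v => Sim (FgEquiv n) u v ∧ Sim (FgEquiv n) v u

section Sim

variable {R S T : GWord A → GWord A → Prop} {u v w : GWord A}

theorem FirstSim.comp (h : FirstSim R u v) (h' : FirstSim S v w)
    (hT : ∀ {x y z}, R x y → S y z → T x z) : FirstSim T u w := fun a p hp => by
  obtain ⟨q, hq, h₁, h₂⟩ := h a p hp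
  obtain ⟨r, hr, h₃, h₄⟩ := h' a q hq
  exact ⟨r, hr, hT h₁ h₃, hT h₂ h₄⟩

theorem LastSim.comp (h : LastSim R u v) (h' : LastSim S v w)
    (hT : ∀ {x y z}, R x y → S y z → T x z) : LastSim T u w := fun a p hp => by
  obtain ⟨q, hq, h₁, h₂⟩ := h a p hp
  obtain ⟨r, hr, h₃, h₄⟩ := h' a q hq
  exact ⟨r, hr, hT h₁ h₃, hT h₂ h₄⟩

theorem BetweenSim.comp (h : BetweenSim R u v) (h' : BetweenSim S v w)
    (hT : ∀ {x y z}, R x y → S y z → T x z) : BetweenSim T u w := fun a b p q hp hq hpq => by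
  obtain ⟨p', q', hp', hq', hpq', h₁⟩ := h a b p q hp hq hpq
  obtain ⟨p'', q'', hp'', hq'', hpq'', h₂⟩ := h' a b p' q' hp' hq' hpq'
  exact ⟨p'', q'', hp'', hq'', hpq'', hT h₁ h₂⟩

theorem Sim.comp (h : Sim R u v) (h' : Sim S v w)
    (hT : ∀ {x y z}, R x y → S y z → T x z) : Sim T u w :=
  ⟨h.alph.trans h'.alph, h.first.comp h'.first hT, h.last.comp h'.last hT,
    h.between.comp h'.between hT⟩

theorem Sim.mono (h : Sim R u v) (hRS : ∀ {x y}, R x y → S x y) : Sim S u v where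
  alph := h.alph
  first a p hp := by
    obtain ⟨q, hq, h₁, h₂⟩ := h.first a p hp
    exact ⟨q, hq, hRS h₁, hRS h₂⟩
  last a p hp := by
    obtain ⟨q, hq, h₁, h₂⟩ := h.last a p hp
    exact ⟨q, hq, hRS h₁, hRS h₂⟩
  between a b p q hp hq hpq := by
    obtain ⟨p', q', hp', hq', hpq', h₁⟩ := h.between a b p q hp hq hpq
    exact ⟨p', q', hp', hq', hpq', hRS h₁⟩

theorem Iso.sim (h : u.Iso v) (hR : ∀ {x y}, Iso x y → R x y) : Sim R u v := by
  obtain ⟨f, hf, hs, hw⟩ := h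
  have first {a p} (hp : u.IsFirst a p) : v.IsFirst a (f p) := by
    refine ⟨(hw p).trans hp.1, fun q hq => ?_⟩
    obtain ⟨q, rfl⟩ := hs q
    exact hf.monotone (hp.2 q ((hw q).symm.trans hq))
  have last {a p} (hp : u.IsLast a p) : v.IsLast a (f p) := by
    refine ⟨(hw p).trans hp.1, fun q hq => ?_⟩
    obtain ⟨q, rfl⟩ := hs q
    exact hf.monotone (hp.2 q ((hw q).symm.trans hq))
  refine ⟨?_, fun a p hp => ⟨f p, first hp, ?_, ?_⟩, fun a p hp => ⟨f p, last hp, ?_, ?_⟩,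
    fun a b p q hp hq hpq => ⟨f p, f q, first hp, last hq, hf hpq, ?_⟩⟩
  · rintro a ⟨p, rfl⟩
    exact ⟨f p, hw p⟩
  all_goals exact hR (iso_restrict hf hs hw fun r => by simp [hf.lt_iff_lt])

end Sim

theorem FgEquiv.symm {n : ℕ} {u v : GWord A} (h : FgEquiv n u v) : FgEquiv n v u := by
  cases n
  exacts [trivial, And.symm h]

theorem FgEquiv.trans {n : ℕ} {u v w : GWord A} (h : FgEquiv n u v) (h' : FgEquiv n v w) :
    FgEquiv n u w := by
  induction n generalizing u v w with
  | zero => trivial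
  | succ n ih => exact ⟨h.1.comp h'.1 ih, h'.2.comp h.2 ih⟩

theorem Iso.fgEquiv {u v : GWord A} (h : u.Iso v) (n : ℕ) : FgEquiv n u v := by
  induction n generalizing u v with
  | zero => trivial
  | succ n ih => exact ⟨h.sim ih, h.symm.sim ih⟩

theorem FgEquiv.of_succ {n : ℕ} {u v : GWord A} (h : FgEquiv (n + 1) u v) : FgEquiv n u v := by
  induction n generalizing u v with
  | zero => trivial
  | succ n ih => exact ⟨h.1.mono ih, h.2.mono ih⟩

theorem FgEquiv.alph_eq {n : ℕ} {u v : GWord A} (h : FgEquiv (n + 1) u v) : u.alph = v.alph :=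
  h.1.alph.antisymm h.2.alph

/-! ### Compatibility with concatenation -/

section Append

variable {n : ℕ} {u v u' v' : GWord A}

theorem fgEquiv_restrict_univ (h : FgEquiv n u v) {s : Set u.P} {t : Set v.P}
    (hs : ∀ p, p ∈ s) (ht : ∀ p, p ∈ t) : FgEquiv n (u.restrict s) (v.restrict t) := by
  rw [Set.eq_univ_of_forall hs, Set.eq_univ_of_forall ht]
  exact ((restrict_univ_iso u).fgEquiv n).trans (h.trans ((restrict_univ_iso v).symm.fgEquiv n))

theorem fgEquiv_restrict_empty (n : ℕ) {s : Set u.P} {t : Set v.P}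
    (hs : ∀ p, p ∉ s) (ht : ∀ p, p ∉ t) : FgEquiv n (u.restrict s) (v.restrict t) := by
  rw [Set.eq_empty_of_forall_notMem hs, Set.eq_empty_of_forall_notMem ht]
  exact (restrict_empty_iso u v).fgEquiv n

theorem fgEquiv_restrict_of_iff {s s' : Set u.P} {t t' : Set v.P}
    (h : FgEquiv n (u.restrict s') (v.restrict t')) (hs : ∀ p, p ∈ s ↔ p ∈ s')
    (ht : ∀ p, p ∈ t ↔ p ∈ t') : FgEquiv n (u.restrict s) (v.restrict t) := by
  rwa [Set.ext hs, Set.ext ht]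

/-- Factors of concatenations are equivalent if their intersections with the two sides are. -/
theorem fgEquiv_restrict_append
    (happ : ∀ {x y x' y' : GWord A}, FgEquiv n x x' → FgEquiv n y y' →
      FgEquiv n (x.append y) (x'.append y'))
    {s : Set (u.append v).P} {t : Set (u'.append v').P}
    (hl : FgEquiv n (u.restrict (appendL v ⁻¹' s)) (u'.restrict (appendL v' ⁻¹' t)))
    (hr : FgEquiv n (v.restrict (appendR u ⁻¹' s)) (v'.restrict (appendR u' ⁻¹' t))) :
    FgEquiv n ((u.append v).restrict s) ((u'.append v').restrict t) :=
  ((restrict_append_iso u v s).fgEquiv n).trans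
    ((happ hl hr).trans ((restrict_append_iso u' v' t).symm.fgEquiv n))

theorem sim_append
    (happ : ∀ {x y x' y' : GWord A}, FgEquiv n x x' → FgEquiv n y y' →
      FgEquiv n (x.append y) (x'.append y'))
    (hu : FgEquiv (n + 1) u u') (hv : FgEquiv (n + 1) v v') :
    Sim (FgEquiv n) (u.append v) (u'.append v') where
  alph := by
    rw [alph_append, alph_append, hu.alph_eq, hv.alph_eq]
  first a p hp := by
    obtain ⟨p, rfl⟩ | ⟨p, rfl⟩ := append_cases p
    · obtain ⟨q, hq, h₁, h₂⟩ := hu.1.first a p (isFirst_appendL.1 hp)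
      refine ⟨appendL v' q, isFirst_appendL.2 hq, fgEquiv_restrict_append happ
        (fgEquiv_restrict_of_iff h₁ ?_ ?_) (fgEquiv_restrict_empty n ?_ ?_),
        fgEquiv_restrict_append happ (fgEquiv_restrict_of_iff h₂ ?_ ?_)
        (fgEquiv_restrict_univ hv.of_succ ?_ ?_)⟩ <;> simp
    · obtain ⟨ha, hp⟩ := isFirst_appendR.1 hp
      obtain ⟨q, hq, h₁, h₂⟩ := hv.1.first a p hp
      refine ⟨appendR u' q, isFirst_appendR.2 ⟨hu.alph_eq ▸ ha, hq⟩,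
        fgEquiv_restrict_append happ (fgEquiv_restrict_univ hu.of_succ ?_ ?_)
        (fgEquiv_restrict_of_iff h₁ ?_ ?_), fgEquiv_restrict_append happ
        (fgEquiv_restrict_empty n ?_ ?_) (fgEquiv_restrict_of_iff h₂ ?_ ?_)⟩ <;> simp
  last a p hp := by
    obtain ⟨p, rfl⟩ | ⟨p, rfl⟩ := append_cases p
    · obtain ⟨ha, hp⟩ := isLast_appendL.1 hp
      obtain ⟨q, hq, h₁, h₂⟩ := hu.1.last a p hp
      refine ⟨appendL v' q, isLast_appendL.2 ⟨hv.alph_eq ▸ ha, hq⟩, fgEquiv_restrict_append happ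
        (fgEquiv_restrict_of_iff h₁ ?_ ?_) (fgEquiv_restrict_empty n ?_ ?_),
        fgEquiv_restrict_append happ (fgEquiv_restrict_of_iff h₂ ?_ ?_)
        (fgEquiv_restrict_univ hv.of_succ ?_ ?_)⟩ <;> simp
    · obtain ⟨q, hq, h₁, h₂⟩ := hv.1.last a p (isLast_appendR.1 hp)
      refine ⟨appendR u' q, isLast_appendR.2 hq,
        fgEquiv_restrict_append happ (fgEquiv_restrict_univ hu.of_succ ?_ ?_)
        (fgEquiv_restrict_of_iff h₁ ?_ ?_), fgEquiv_restrict_append happ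
        (fgEquiv_restrict_empty n ?_ ?_) (fgEquiv_restrict_of_iff h₂ ?_ ?_)⟩ <;> simp
  between a b p q hp hq hpq := by
    obtain ⟨p, rfl⟩ | ⟨p, rfl⟩ := append_cases p <;> obtain ⟨q, rfl⟩ | ⟨q, rfl⟩ := append_cases q
    · obtain ⟨hb, hq⟩ := isLast_appendL.1 hq
      obtain ⟨p', q', hp', hq', hpq', h⟩ := hu.1.between a b p q (isFirst_appendL.1 hp) hq
        (appendL_lt_appendL.1 hpq)
      refine ⟨appendL v' p', appendL v' q', isFirst_appendL.2 hp',
        isLast_appendL.2 ⟨hv.alph_eq ▸ hb, hq'⟩, appendL_lt_appendL.2 hpq',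
        fgEquiv_restrict_append happ (fgEquiv_restrict_of_iff h ?_ ?_)
        (fgEquiv_restrict_empty n ?_ ?_)⟩ <;> simp
    · exact (not_appendR_lt_appendL _ _ hpq).elim
    · obtain ⟨ha, hp⟩ := isFirst_appendR.1 hp
      obtain ⟨hb, hq⟩ := isLast_appendL.1 hq
      obtain ⟨p', hp', h₁, -⟩ := hv.1.first a p hp
      obtain ⟨q', hq', -, h₂⟩ := hu.1.last b q hq
      refine ⟨appendR u' p', appendL v' q', isFirst_appendR.2 ⟨hu.alph_eq ▸ ha, hp'⟩,
        isLast_appendL.2 ⟨hv.alph_eq ▸ hb, hq'⟩, appendL_lt_appendR _ _,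
        fgEquiv_restrict_append happ (fgEquiv_restrict_of_iff h₂ ?_ ?_)
        (fgEquiv_restrict_of_iff h₁ ?_ ?_)⟩ <;> simp
    · obtain ⟨ha, hp⟩ := isFirst_appendR.1 hp
      obtain ⟨p', q', hp', hq', hpq', h⟩ := hv.1.between a b p q hp (isLast_appendR.1 hq)
        (appendR_lt_appendR.1 hpq)
      refine ⟨appendR u' p', appendR u' q', isFirst_appendR.2 ⟨hu.alph_eq ▸ ha, hp'⟩,
        isLast_appendR.2 hq', appendR_lt_appendR.2 hpq',
        fgEquiv_restrict_append happ (fgEquiv_restrict_empty n ?_ ?_)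
        (fgEquiv_restrict_of_iff h ?_ ?_)⟩ <;> simp

theorem FgEquiv.append (hu : FgEquiv n u u') (hv : FgEquiv n v v') :
    FgEquiv n (u.append v) (u'.append v') := by
  induction n generalizing u v u' v' with
  | zero => trivial
  | succ n ih => exact ⟨sim_append ih hu hv, sim_append ih hu.symm hv.symm⟩

end Append

/-! ### Compatibility with powers -/

theorem firstSim_append_of_alph_eq {n : ℕ} {u v s t : GWord A} (h : FgEquiv (n + 1) u v)
    (hst : FgEquiv n s t) (hs : s.alph = u.alph) :
    FirstSim (FgEquiv n) (u.append s) (v.append t) := fun a p hp => by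
  obtain ⟨p, rfl⟩ | ⟨p, rfl⟩ := append_cases p
  · obtain ⟨q, hq, h₁, h₂⟩ := h.1.first a p (isFirst_appendL.1 hp)
    refine ⟨appendL t q, isFirst_appendL.2 hq, fgEquiv_restrict_append FgEquiv.append
      (fgEquiv_restrict_of_iff h₁ ?_ ?_) (fgEquiv_restrict_empty n ?_ ?_),
      fgEquiv_restrict_append FgEquiv.append (fgEquiv_restrict_of_iff h₂ ?_ ?_)
      (fgEquiv_restrict_univ hst ?_ ?_)⟩ <;> simp
  · obtain ⟨ha, hp⟩ := isFirst_appendR.1 hp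
    exact (ha (hs ▸ ⟨p, hp.1⟩)).elim

theorem lastSim_append_of_alph_eq {n : ℕ} {u v s t : GWord A} (h : FgEquiv (n + 1) u v)
    (hst : FgEquiv n s t) (hs : s.alph = u.alph) :
    LastSim (FgEquiv n) (s.append u) (t.append v) := fun a p hp => by
  obtain ⟨p, rfl⟩ | ⟨p, rfl⟩ := append_cases p
  · obtain ⟨ha, hp⟩ := isLast_appendL.1 hp
    exact (ha (hs ▸ ⟨p, hp.1⟩)).elim
  · obtain ⟨q, hq, h₁, h₂⟩ := h.1.last a p (isLast_appendR.1 hp)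
    refine ⟨appendR t q, isLast_appendR.2 hq,
      fgEquiv_restrict_append FgEquiv.append (fgEquiv_restrict_univ hst ?_ ?_)
      (fgEquiv_restrict_of_iff h₁ ?_ ?_), fgEquiv_restrict_append FgEquiv.append
      (fgEquiv_restrict_empty n ?_ ?_) (fgEquiv_restrict_of_iff h₂ ?_ ?_)⟩ <;> simp

theorem betweenSim_append_of_alph_eq {R : GWord A → GWord A → Prop} {u s w : GWord A}
    (hs : s.alph = u.alph) : BetweenSim R (u.append s) w := fun a b p q hp hq hpq => by
  exfalso
  obtain ⟨p, rfl⟩ | ⟨p, rfl⟩ := append_cases p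
  · obtain ⟨q, rfl⟩ | ⟨q, rfl⟩ := append_cases q
    · obtain ⟨hb, hq⟩ := isLast_appendL.1 hq
      exact hb (hs ▸ ⟨q, hq.1⟩)
    · exact not_appendR_lt_appendL _ _ hpq
  · obtain ⟨ha, hp⟩ := isFirst_appendR.1 hp
    exact ha (hs ▸ ⟨p, hp.1⟩)

theorem sim_of_iso_append {n : ℕ} {u v s t x y : GWord A} (h : FgEquiv (n + 1) u v)
    (hst : FgEquiv n s t) (hs : s.alph = u.alph)
    (hx : x.Iso (u.append s)) (hx' : x.Iso (s.append u))
    (hy : y.Iso (v.append t)) (hy' : y.Iso (t.append v)) : Sim (FgEquiv n) x y where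
  alph := by
    refine (hx.fgEquiv 1).alph_eq.subset.trans (subset_trans ?_ (hy.fgEquiv 1).alph_eq.superset)
    rw [alph_append, alph_append, hs, h.alph_eq, Set.union_self]
    exact Set.subset_union_left
  first := ((hx.fgEquiv (n + 1)).1.first.comp (firstSim_append_of_alph_eq h hst hs)
    FgEquiv.trans).comp (hy.symm.fgEquiv (n + 1)).1.first FgEquiv.trans
  last := ((hx'.fgEquiv (n + 1)).1.last.comp (lastSim_append_of_alph_eq h hst hs)
    FgEquiv.trans).comp (hy'.symm.fgEquiv (n + 1)).1.last FgEquiv.trans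
  between := (hx.fgEquiv (n + 1)).1.between.comp (betweenSim_append_of_alph_eq (w := y) hs)
    FgEquiv.trans

end GWord

open GWord

section

variable {A : Type}

theorem listNPow_succ' (l : List A) (k : ℕ) : listNPow l (k + 1) = listNPow l k ++ l := by
  induction k with
  | zero => simp [listNPow]
  | succ k ih => rw [listNPow, ih, ← List.append_assoc, ← listNPow, ih]

theorem mem_listNPow_succ {l : List A} {k : ℕ} {a : A} : a ∈ listNPow l (k + 1) ↔ a ∈ l := by
  induction k with
  | zero => simp [listNPow]
  | succ k ih => rw [listNPow, List.mem_append, ih, or_self]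

theorem fgEquiv_listNPow_gpow {n k : ℕ} (hk : n < k) {l : List A} {v : GWord A}
    (h : FgEquiv n (ofList l) v) : FgEquiv n (ofList (listNPow l k)) (v.gpow OO) := by
  induction n generalizing k with
  | zero => trivial
  | succ n ih =>
    obtain ⟨k, rfl⟩ : ∃ j, k = j + 2 := ⟨k - 2, by omega⟩
    have hst := ih (k := k + 1) (by omega) h.of_succ
    have hs : (ofList (listNPow l (k + 1))).alph = (ofList l).alph := by
      rw [alph_ofList, alph_ofList]
      exact Set.ext fun _ => mem_listNPow_succ
    have hx := ofList_append_iso l (listNPow l (k + 1))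
    have hx' := ofList_append_iso (listNPow l (k + 1)) l
    rw [← listNPow] at hx
    rw [← listNPow_succ'] at hx'
    exact ⟨sim_of_iso_append h hst hs hx hx' v.gpow_OO_iso_cons v.gpow_OO_iso_snoc,
      sim_of_iso_append h.symm hst.symm (alph_gpow v OO) v.gpow_OO_iso_cons v.gpow_OO_iso_snoc
        hx hx'⟩

theorem fgEquiv_substNat_substOO {n k : ℕ} (γ : PiTerm A) (hk : n < k) :
    FgEquiv n (ofList (γ.substNat k)) γ.substOO := by
  induction γ with
  | eps => exact (Iso.refl _).fgEquiv n
  | letter a => exact (Iso.refl _).fgEquiv n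
  | mul α β hα hβ => exact ((ofList_append_iso _ _).fgEquiv n).trans (hα.append hβ)
  | pi γ h => exact fgEquiv_listNPow_gpow hk h

end

/-! ## From `FgEquiv` to the relations `≡_{m,n}^Z` -/

namespace GWord

variable {A : Type}

theorem IsFirst.unique {u : GWord A} {a : A} {p q : u.P} (hp : u.IsFirst a p)
    (hq : u.IsFirst a q) : p = q :=
  (hp.2 q hq.1).antisymm (hq.2 p hp.1)

theorem IsLast.unique {u : GWord A} {a : A} {p q : u.P} (hp : u.IsLast a p)
    (hq : u.IsLast a q) : p = q :=
  (hq.2 p hp.1).antisymm (hp.2 q hq.1)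

theorem IsFirst.XL_eq {u : GWord A} {a : A} {p : u.P} (hp : u.IsFirst a p) :
    u.XL a = u.restrict {q | q < p} := by
  have h : ∃ p, u.IsFirst a p := ⟨p, hp⟩
  rw [XL, dif_pos h, h.choose_spec.unique hp]

theorem IsFirst.XR_eq {u : GWord A} {a : A} {p : u.P} (hp : u.IsFirst a p) :
    u.XR a = u.restrict {q | p < q} := by
  have h : ∃ p, u.IsFirst a p := ⟨p, hp⟩
  rw [XR, dif_pos h, h.choose_spec.unique hp]

theorem IsLast.YL_eq {u : GWord A} {a : A} {p : u.P} (hp : u.IsLast a p) :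
    u.YL a = u.restrict {q | q < p} := by
  have h : ∃ p, u.IsLast a p := ⟨p, hp⟩
  rw [YL, dif_pos h, h.choose_spec.unique hp]

theorem IsLast.YR_eq {u : GWord A} {a : A} {p : u.P} (hp : u.IsLast a p) :
    u.YR a = u.restrict {q | p < q} := by
  have h : ∃ p, u.IsLast a p := ⟨p, hp⟩
  rw [YR, dif_pos h, h.choose_spec.unique hp]

theorem Cab_eq {u : GWord A} {a b : A} {p q : u.P} (hp : u.IsFirst a p) (hq : u.IsLast b q)
    (hpq : q < p) : u.Cab a b = u.restrict {r | q < r ∧ r < p} := by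
  have h : u.CDefined a b := ⟨p, q, hp, hq, hpq⟩
  have hs := h.choose_spec.choose_spec
  rw [Cab, dif_pos h, hs.2.1.unique hq, hs.1.unique hp]

theorem FgEquiv.X {n : ℕ} {u v : GWord A} (h : FgEquiv (n + 1) u v) (a : A) :
    FgEquiv n (u.XL a) (v.XL a) ∧ FgEquiv n (u.XR a) (v.XR a) := by
  by_cases hu : ∃ p, u.IsFirst a p
  · obtain ⟨p, hp⟩ := hu
    obtain ⟨q, hq, h₁, h₂⟩ := h.1.first a p hp
    rw [hp.XL_eq, hp.XR_eq, hq.XL_eq, hq.XR_eq]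
    exact ⟨h₁, h₂⟩
  · have hv : ¬ ∃ q, v.IsFirst a q := fun ⟨q, hq⟩ =>
      hu ((h.2.first a q hq).imp fun _ => And.left)
    rw [XL, XR, XL, XR, dif_neg hu, dif_neg hu, dif_neg hv, dif_neg hv]
    exact ⟨h.of_succ, h.of_succ⟩

theorem FgEquiv.Y {n : ℕ} {u v : GWord A} (h : FgEquiv (n + 1) u v) (a : A) :
    FgEquiv n (u.YL a) (v.YL a) ∧ FgEquiv n (u.YR a) (v.YR a) := by
  by_cases hu : ∃ p, u.IsLast a p
  · obtain ⟨p, hp⟩ := hu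
    obtain ⟨q, hq, h₁, h₂⟩ := h.1.last a p hp
    rw [hp.YL_eq, hp.YR_eq, hq.YL_eq, hq.YR_eq]
    exact ⟨h₁, h₂⟩
  · have hv : ¬ ∃ q, v.IsLast a q := fun ⟨q, hq⟩ =>
      hu ((h.2.last a q hq).imp fun _ => And.left)
    rw [YL, YR, YL, YR, dif_neg hu, dif_neg hu, dif_neg hv, dif_neg hv]
    exact ⟨h.of_succ, h.of_succ⟩

theorem Sim.cDefined {R : GWord A → GWord A → Prop} {u v : GWord A} (h : Sim R u v) {a b : A} :
    u.CDefined a b → v.CDefined a b := by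
  rintro ⟨p, q, hp, hq, hpq⟩
  obtain ⟨p', q', hp', hq', hpq', -⟩ := h.between a b p q hp hq hpq
  exact ⟨p', q', hp', hq', hpq'⟩

theorem FgEquiv.Cab {n : ℕ} {u v : GWord A} (h : FgEquiv (n + 1) u v) {a b : A}
    (hu : u.CDefined a b) : FgEquiv n (u.Cab a b) (v.Cab a b) := by
  obtain ⟨p, q, hp, hq, hpq⟩ := hu
  obtain ⟨p', q', hp', hq', hpq', h'⟩ := h.1.between a b p q hp hq hpq
  rwa [Cab_eq hp hq hpq, Cab_eq hp' hq' hpq']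

theorem FgEquiv.eqvAux {n : ℕ} {u v : GWord A} (h : FgEquiv n u v) (K : ZK) (m : ℕ) :
    eqvAux n K m u v := by
  induction n generalizing u v K m with
  | zero => simp [_root_.eqvAux]
  | succ n ih =>
    obtain _ | m := m
    · simp [_root_.eqvAux]
    · cases K <;> rw [_root_.eqvAux]
      · exact ⟨h.alph_eq, ih h.of_succ _ _, fun a _ => ⟨ih (h.X a).1 _ _, ih (h.X a).2 _ _⟩⟩
      · exact ⟨h.alph_eq, ih h.of_succ _ _, fun a _ => ⟨ih (h.Y a).1 _ _, ih (h.Y a).2 _ _⟩⟩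
      · exact ⟨h.alph_eq, fun a _ => ⟨ih (h.X a).1 _ _, ih (h.X a).2 _ _, ih (h.Y a).1 _ _,
          ih (h.Y a).2 _ _⟩, fun a _ b _ => ⟨⟨h.1.cDefined, h.2.cDefined⟩,
          fun hu _ => ih (h.Cab hu) _ _⟩⟩

end GWord

/-- Lemma: for finitely many factorization steps only finitely many positions matter. -/
theorem substNat_equiv_substOO (A : Type) [Fintype A] (m n : ℕ) (Z : ZKind)
    (γ : PiTerm A) : ∀ k : ℕ, n < k →
      wEquiv Z m n (GWord.ofList (γ.substNat k)) γ.substOO := by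
  intro k hk
  have h := fgEquiv_substNat_substOO γ hk
  cases Z
  · exact h.eqvAux _ _
  · exact h.eqvAux _ _
  · exact ⟨h.eqvAux _ _, h.eqvAux _ _⟩
  · exact h.eqvAux _ _
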